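/- arXiv:0903.0846 — 5 statements merged into one kernel-verified Lean document; each statement's English description precedes it below -/
import Mathlib

section
/- Let n ≥ 1, let p : ℝ² → Mat_{n×n}(ℂ) be a matrix-valued function, ρ₀ ∈ ℝ², z₀ ∈ ℂ, and define q(x, ξ) := det(p(x, ξ) − z₀·I). Suppose there exist an open neighborhood U of ρ₀ and functions λ : U → ℂ and g : U → ℂ, differentiable at ρ₀, with λ(ρ₀) = z₀, g(ρ₀) ≠ 0, and q(x, ξ) = g(x, ξ)·(z₀ − λ(x, ξ)) for all (x, ξ) ∈ U. Then (1/2i){q, q̄}(ρ₀) > 0 if and only if (1/2i){λ, λ̄}(ρ₀) > 0. -/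
open Complex
open scoped ComplexOrder

/-- The Poisson bracket `{f, g}(ρ) = (∂_ξ f ∂_x g − ∂_x f ∂_ξ g)(ρ)` of two functions on
`ℝ²_{x,ξ}`. -/
noncomputable def poissonBracket (f g : ℝ × ℝ → ℂ) (ρ : ℝ × ℝ) : ℂ :=
  fderiv ℝ f ρ (0, 1) * fderiv ℝ g ρ (1, 0) - fderiv ℝ f ρ (1, 0) * fderiv ℝ g ρ (0, 1)

/-- If `q` agrees near `ρ₀` with `g * (c - f)` and `f ρ₀ = c`, then the derivative of `q` at `ρ₀`
is `-g ρ₀` times that of `f`. -/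
theorem hasFDerivAt_of_eventuallyEq_mul_const_sub {E : Type*} [NormedAddCommGroup E]
    [NormedSpace ℝ E] {q f g : E → ℂ} {ρ₀ : E} {c : ℂ} (hf : DifferentiableAt ℝ f ρ₀)
    (hg : DifferentiableAt ℝ g ρ₀) (hf0 : f ρ₀ = c)
    (hq : q =ᶠ[nhds ρ₀] fun ρ => g ρ * (c - f ρ)) :
    HasFDerivAt q (-g ρ₀ • fderiv ℝ f ρ₀) ρ₀ := by
  refine HasFDerivAt.congr_of_eventuallyEq ?_ hq
  refine (hg.hasFDerivAt.mul (hf.hasFDerivAt.const_sub c)).congr_fderiv ?_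
  ext v
  simp [hf0]

/-- The derivative of a complex conjugate is the conjugate of the derivative. -/
theorem HasFDerivAt.starRingEnd_apply {E : Type*} [NormedAddCommGroup E] [NormedSpace ℝ E]
    {f : E → ℂ} {f' : E →L[ℝ] ℂ} {ρ : E} (hf : HasFDerivAt f f' ρ) (v : E) :
    fderiv ℝ (fun x => starRingEnd ℂ (f x)) ρ v = starRingEnd ℂ (f' v) := by
  have h : HasFDerivAt (fun x => starRingEnd ℂ (f x))
      ((Complex.conjCLE : ℂ →L[ℝ] ℂ).comp f') ρ :=
    (Complex.conjCLE : ℂ →L[ℝ] ℂ).hasFDerivAt.comp ρ hf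
  rw [h.fderiv]
  simp

/-- Scaling the differential of `f` by `a` scales the bracket `{f, f̄}` by `|a|²`. -/
theorem poissonBracket_conj_of_hasFDerivAt_smul {q f : ℝ × ℝ → ℂ} {ρ : ℝ × ℝ} {a : ℂ}
    (hf : DifferentiableAt ℝ f ρ) (hq : HasFDerivAt q (a • fderiv ℝ f ρ) ρ) :
    poissonBracket q (fun x => starRingEnd ℂ (q x)) ρ =
      (Complex.normSq a : ℂ) * poissonBracket f (fun x => starRingEnd ℂ (f x)) ρ := by
  simp only [poissonBracket, hq.starRingEnd_apply, hf.hasFDerivAt.starRingEnd_apply, hq.fderiv,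
    smul_apply, smul_eq_mul, map_mul, ← Complex.mul_conj]
  ring

/-- if `q = det(p − z₀)` factors as `q = g·(z₀ − λ)` near `ρ₀`, with `λ(ρ₀) = z₀`
and `g(ρ₀) ≠ 0`, then `(1/2i){q, q̄}(ρ₀) > 0 ↔ (1/2i){λ, λ̄}(ρ₀) > 0`. -/
theorem poissonBracket_det_pos_iff_eigenvalue_pos
    {n : ℕ} (hn : 1 ≤ n) (p : ℝ × ℝ → Matrix (Fin n) (Fin n) ℂ)
    (ρ₀ : ℝ × ℝ) (z₀ : ℂ) (U : Set (ℝ × ℝ)) (hU : IsOpen U) (hρ₀ : ρ₀ ∈ U)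
    (lam g : ℝ × ℝ → ℂ)
    (hlam : DifferentiableAt ℝ lam ρ₀) (hg : DifferentiableAt ℝ g ρ₀)
    (hlam0 : lam ρ₀ = z₀) (hg0 : g ρ₀ ≠ 0)
    (hfac : ∀ ρ ∈ U,
      (p ρ - z₀ • (1 : Matrix (Fin n) (Fin n) ℂ)).det = g ρ * (z₀ - lam ρ)) :
    (0 < 1 / (2 * Complex.I) *
        poissonBracket (fun ρ => (p ρ - z₀ • (1 : Matrix (Fin n) (Fin n) ℂ)).det)
          (fun ρ => starRingEnd ℂ ((p ρ - z₀ • (1 : Matrix (Fin n) (Fin n) ℂ)).det)) ρ₀) ↔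
      (0 < 1 / (2 * Complex.I) *
        poissonBracket lam (fun ρ => starRingEnd ℂ (lam ρ)) ρ₀) := by
  have hq := hasFDerivAt_of_eventuallyEq_mul_const_sub hlam hg hlam0
    (Filter.eventually_of_mem (hU.mem_nhds hρ₀) hfac)
  have hpos : (0 : ℂ) < Complex.normSq (-g ρ₀) :=
    Complex.zero_lt_real.2 (Complex.normSq_pos.2 (neg_ne_zero.2 hg0))
  rw [poissonBracket_conj_of_hasFDerivAt_smul hlam hq, mul_left_comm]
  exact mul_pos_iff_of_pos_left hpos
end

section
/- Let n ≥ 1, let p : ℝ² → Mat_{n×n}(ℂ) be differentiable at ρ₀ ∈ ℝ², let z₀ ∈ ℂ, and suppose dim_ℂ ker(p(ρ₀) − z₀·I) ≥ 2. Define q(ρ) := det(p(ρ) − z₀·I). Then the (total) derivative of q at ρ₀ vanishes; in particular (1/2i){q, q̄}(ρ₀) = 0. -/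
open Complex

open scoped Matrix in
/-- If `ker A` has dimension at least `2`, replacing one column of `A` keeps it singular. -/
theorem Matrix.det_updateCol_eq_zero_of_two_le_finrank_ker {K ι : Type*} [Field K] [Fintype ι]
    [DecidableEq ι] (A : Matrix ι ι K) (hA : 2 ≤ Module.finrank K (LinearMap.ker A.mulVecLin))
    (i : ι) (c : ι → K) : (A.updateCol i c).det = 0 := by
  let φ : LinearMap.ker A.mulVecLin →ₗ[K] K :=
    (LinearMap.proj i : (ι → K) →ₗ[K] K) ∘ₗ (LinearMap.ker A.mulVecLin).subtype
  have hφ : LinearMap.ker φ ≠ ⊥ := by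
    apply LinearMap.ker_ne_bot_of_finrank_lt
    rw [Module.finrank_self]
    lia
  obtain ⟨⟨u, hu⟩, hui, hu0⟩ := Submodule.exists_mem_ne_zero_of_ne_bot hφ
  replace hui : u i = 0 := hui
  replace hu : A *ᵥ u = 0 := hu
  refine Matrix.exists_mulVec_eq_zero_iff.mp ⟨u, fun h => hu0 (Subtype.ext h), ?_⟩
  rw [← hu]
  ext k
  refine Finset.sum_congr rfl fun j _ => ?_
  by_cases hj : j = i
  · subst hj
    simp [hui]
  · simp [Matrix.updateCol_ne hj]

open scoped Matrix in
/-- The determinant, as a function of the rows, has vanishing derivative at `Aᵀ` as soon as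
`ker A` has dimension at least `2`. -/
theorem Matrix.hasFDerivAt_detRowAlternating_zero {𝕜 ι : Type*} [NontriviallyNormedField 𝕜]
    [Fintype ι] [DecidableEq ι] (A : Matrix ι ι 𝕜)
    (hA : 2 ≤ Module.finrank 𝕜 (LinearMap.ker A.mulVecLin)) :
    HasFDerivAt (fun v : ι → ι → 𝕜 => Matrix.detRowAlternating v)
      (0 : (ι → ι → 𝕜) →L[𝕜] 𝕜) (fun i j => A j i) := by
  let D : ContinuousMultilinearMap 𝕜 (fun _ : ι => ι → 𝕜) 𝕜 :=
    { (Matrix.detRowAlternating : (ι → 𝕜) [⋀^ι]→ₗ[𝕜] 𝕜).toMultilinearMap with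
      cont := Continuous.matrix_det (A := fun v : ι → ι → 𝕜 => (v : Matrix ι ι 𝕜)) continuous_id }
  have hD := D.hasFDerivAt (x := fun i j => A j i)
  have hzero : D.linearDeriv (fun i j => A j i) = 0 := by
    ext1 v
    rw [ContinuousMultilinearMap.linearDeriv_apply]
    refine Finset.sum_eq_zero fun i _ => ?_
    change (Matrix.updateRow Aᵀ i (v i)).det = 0
    rw [Matrix.updateRow_transpose, Matrix.det_transpose]
    exact A.det_updateCol_eq_zero_of_two_le_finrank_ker hA i (v i)
  rw [hzero] at hD
  exact hD

/-- if `dim ker(p(ρ₀) − z₀) ≥ 2` then the derivative of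
`q(ρ) = det(p(ρ) − z₀)` vanishes at `ρ₀`; in particular `(1/2i){q, q̄}(ρ₀) = 0`. -/
theorem fderiv_det_eq_zero_of_two_le_finrank_ker
    {n : ℕ} (hn : 1 ≤ n) (p : ℝ × ℝ → Matrix (Fin n) (Fin n) ℂ) (ρ₀ : ℝ × ℝ) (z₀ : ℂ)
    (hp : ∀ i j, DifferentiableAt ℝ (fun ρ => p ρ i j) ρ₀)
    (hker : 2 ≤ Module.finrank ℂ
      (LinearMap.ker (p ρ₀ - z₀ • (1 : Matrix (Fin n) (Fin n) ℂ)).mulVecLin)) :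
    fderiv ℝ (fun ρ => (p ρ - z₀ • (1 : Matrix (Fin n) (Fin n) ℂ)).det) ρ₀ = 0 ∧
    1 / (2 * Complex.I) *
      poissonBracket (fun ρ => (p ρ - z₀ • (1 : Matrix (Fin n) (Fin n) ℂ)).det)
        (fun ρ => starRingEnd ℂ ((p ρ - z₀ • (1 : Matrix (Fin n) (Fin n) ℂ)).det)) ρ₀ = 0 := by
  have hq : HasFDerivAt (fun ρ => (p ρ - z₀ • (1 : Matrix (Fin n) (Fin n) ℂ)).det)
      (0 : ℝ × ℝ →L[ℝ] ℂ) ρ₀ := by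
    have hdet := (Matrix.hasFDerivAt_detRowAlternating_zero _ hker).restrictScalars ℝ
    have hrows : DifferentiableAt ℝ (fun ρ => fun i j =>
        (p ρ - z₀ • (1 : Matrix (Fin n) (Fin n) ℂ)) j i) ρ₀ :=
      differentiableAt_pi.mpr fun i => differentiableAt_pi.mpr fun j =>
        (hp j i).sub_const ((z₀ • (1 : Matrix (Fin n) (Fin n) ℂ)) j i)
    have hcomp := hdet.comp ρ₀ hrows.hasFDerivAt
    rw [ContinuousLinearMap.restrictScalars_zero, ContinuousLinearMap.zero_comp] at hcomp
    exact hcomp.congr_of_eventuallyEq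
      (Filter.Eventually.of_forall fun ρ => (Matrix.det_transpose _).symm)
  refine ⟨hq.fderiv, ?_⟩
  rw [poissonBracket, hq.fderiv]
  simp
end

section
/- Let q : ℝ² → ℂ be C¹ with q(x + 2π, ξ) = q(x, ξ) for all (x, ξ). Assume ellipticity: there exist N ∈ ℕ, a continuous 2π-periodic nonvanishing function a : ℝ → ℂ, and C > 0 such that |q(x, ξ) − a(x) ξ^N| ≤ C (1 + |ξ|)^{N−1} for all (x, ξ). Assume moreover that {q, q̄}(ρ) ≠ 0 at every zero ρ of q. Then the set { (x, ξ) ∈ [0, 2π) × ℝ : q(x, ξ) = 0 } is finite. -/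
open Complex
open scoped Real

/-- If the Poisson bracket `{q, q̄}` is nonzero at `ρ`, then the differential of `q` at `ρ` is
injective. -/
theorem injective_fderiv_of_poissonBracket_conj_ne_zero {q : ℝ × ℝ → ℂ} {ρ : ℝ × ℝ}
    (hq : DifferentiableAt ℝ q ρ)
    (hbr : poissonBracket q (fun p => starRingEnd ℂ (q p)) ρ ≠ 0) :
    Function.Injective (fderiv ℝ q ρ) := by
  have hconj : ∀ v, fderiv ℝ (fun p => starRingEnd ℂ (q p)) ρ v
      = starRingEnd ℂ (fderiv ℝ q ρ v) := by
    intro v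
    have h : HasFDerivAt (fun p => starRingEnd ℂ (q p))
        ((Complex.conjCLE : ℂ →L[ℝ] ℂ).comp (fderiv ℝ q ρ)) ρ :=
      (Complex.conjCLE : ℂ →L[ℝ] ℂ).hasFDerivAt.comp ρ hq.hasFDerivAt
    rw [h.fderiv]
    simp
  unfold poissonBracket at hbr
  rw [hconj, hconj] at hbr
  rw [injective_iff_map_eq_zero]
  rintro ⟨s, t⟩ hst
  have hdecomp : ((s, t) : ℝ × ℝ) = s • ((1, 0) : ℝ × ℝ) + t • ((0, 1) : ℝ × ℝ) := by simp
  rw [hdecomp, map_add, map_smul, map_smul, Complex.real_smul, Complex.real_smul] at hst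
  have hst' := congrArg (starRingEnd ℂ) hst
  simp only [map_add, map_mul, Complex.conj_ofReal, map_zero] at hst'
  generalize fderiv ℝ q ρ (0, 1) = u at *
  generalize fderiv ℝ q ρ (1, 0) = v at *
  have hs : (s : ℂ) = 0 := by
    refine (mul_eq_zero.mp ?_).resolve_right hbr
    linear_combination u * hst' - starRingEnd ℂ u * hst
  have ht : (t : ℂ) = 0 := by
    refine (mul_eq_zero.mp ?_).resolve_right hbr
    linear_combination starRingEnd ℂ v * hst - v * hst'
  rw [Complex.ofReal_eq_zero] at hs ht
  rw [hs, ht, Prod.mk_zero_zero]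

/-- A differentiable function with injective differential at `x`, on a finite-dimensional space,
avoids any given value on a punctured neighbourhood of `x`. -/
theorem eventually_ne_of_injective_fderiv {E F : Type*} [NormedAddCommGroup E] [NormedSpace ℝ E]
    [FiniteDimensional ℝ E] [NormedAddCommGroup F] [NormedSpace ℝ F] {f : E → F} {x : E}
    (hf : DifferentiableAt ℝ f x) (hinj : Function.Injective (fderiv ℝ f x)) (c : F) :
    ∀ᶠ z in nhdsWithin x {x}ᶜ, f z ≠ c := by
  obtain ⟨K, -, hK⟩ := (fderiv ℝ f x).toLinearMap.exists_antilipschitzWith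
    (LinearMap.ker_eq_bot.mpr hinj)
  exact hf.hasFDerivAt.eventually_ne ⟨K, hK⟩

/-- An elliptic symbol with leading coefficient bounded below by `m > 0` has no zeros for large
frequency. -/
theorem abs_le_of_elliptic_of_eq_zero {N : ℕ} {C m ξ : ℝ} {α z : ℂ} (hm : 0 < m)
    (hα : m ≤ ‖α‖) (hell : ‖z - α * (ξ : ℂ) ^ N‖ ≤ C * (1 + |ξ|) ^ ((N : ℝ) - 1))
    (hz : z = 0) : |ξ| ≤ max 1 (C * 2 ^ N / m) := by
  by_contra! h
  obtain ⟨h1, h2⟩ := max_lt_iff.mp h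
  have hpos : 0 < 1 + |ξ| := by positivity
  rw [hz, zero_sub, norm_neg, norm_mul, norm_pow, Complex.norm_real, Real.norm_eq_abs,
    Real.rpow_sub hpos, Real.rpow_natCast, Real.rpow_one, ← mul_div_assoc,
    le_div_iff₀ hpos] at hell
  have hxN : 0 < |ξ| ^ N := by positivity
  have hC : 0 ≤ C := by
    by_contra! hC
    have h3 : C * (1 + |ξ|) ^ N < 0 := mul_neg_of_neg_of_pos hC (by positivity)
    have h4 : 0 ≤ ‖α‖ * |ξ| ^ N * (1 + |ξ|) := by positivity
    linarith
  have hle : (1 + |ξ|) ^ N ≤ 2 ^ N * |ξ| ^ N := by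
    rw [← mul_pow]
    gcongr
    linarith
  have h5 : m * |ξ| ^ N * (1 + |ξ|) ≤ C * (2 ^ N * |ξ| ^ N) :=
    calc m * |ξ| ^ N * (1 + |ξ|) ≤ ‖α‖ * |ξ| ^ N * (1 + |ξ|) := by gcongr
      _ ≤ C * (1 + |ξ|) ^ N := hell
      _ ≤ C * (2 ^ N * |ξ| ^ N) := by gcongr
  rw [div_lt_iff₀ hm] at h2
  have h6 : m * (1 + |ξ|) ≤ C * 2 ^ N := by
    refine le_of_mul_le_mul_right ?_ hxN
    linarith
  linarith

/-- for a `C¹` function `q` on `ℝ²`, `2π`-periodic in `x`, elliptic of order `N`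
with nonvanishing leading coefficient `a(x)`, whose Poisson bracket `{q, q̄}` is nonzero at
every zero of `q`, the zero set of `q` in `[0, 2π) × ℝ` is finite. -/
theorem finite_zeros_of_elliptic_nondegenerate
    (q : ℝ × ℝ → ℂ) (hq : ContDiff ℝ 1 q)
    (hper : ∀ x ξ : ℝ, q (x + 2 * Real.pi, ξ) = q (x, ξ))
    (N : ℕ) (a : ℝ → ℂ) (ha : Continuous a) (hap : ∀ x, a (x + 2 * Real.pi) = a x)
    (ha0 : ∀ x, a x ≠ 0) (C : ℝ) (hC : 0 < C)
    (hell : ∀ x ξ : ℝ, ‖q (x, ξ) - a x * (ξ : ℂ) ^ N‖ ≤ C * (1 + |ξ|) ^ ((N : ℝ) - 1))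
    (hbr : ∀ ρ : ℝ × ℝ, q ρ = 0 → poissonBracket q (fun p => starRingEnd ℂ (q p)) ρ ≠ 0) :
    Set.Finite {ρ : ℝ × ℝ | ρ.1 ∈ Set.Ico 0 (2 * Real.pi) ∧ q ρ = 0} := by
  obtain ⟨x₀, -, hx₀⟩ := (isCompact_Icc (a := (0 : ℝ)) (b := 2 * Real.pi)).exists_isMinOn
    (Set.nonempty_Icc.mpr (by positivity)) ha.norm.continuousOn
  have hsub : {ρ : ℝ × ℝ | ρ.1 ∈ Set.Ico 0 (2 * Real.pi) ∧ q ρ = 0} ⊆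
      Set.Icc 0 (2 * Real.pi) ×ˢ Metric.closedBall 0 (max 1 (C * 2 ^ N / ‖a x₀‖)) := by
    rintro ⟨x, ξ⟩ ⟨hx, hz⟩
    have hx' := Set.Ico_subset_Icc_self hx
    refine ⟨hx', ?_⟩
    rw [mem_closedBall_zero_iff]
    exact abs_le_of_elliptic_of_eq_zero (norm_pos_iff.mpr (ha0 x₀)) (hx₀ hx') (hell x ξ) hz
  by_contra hinf
  obtain ⟨ρ, -, hρ⟩ := Set.Infinite.exists_accPt_of_subset_isCompact hinf
    (isCompact_Icc.prod (isCompact_closedBall _ _)) hsub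
  have hfreq := accPt_iff_frequently_nhdsNE.mp hρ
  have hclosed : IsClosed {σ | q σ = 0} := isClosed_eq hq.continuous continuous_const
  have hzero : q ρ = 0 := hclosed.mem_of_frequently_of_tendsto
    (hfreq.mono fun _ h => h.2) (Filter.tendsto_id.mono_left nhdsWithin_le_nhds)
  have hd : DifferentiableAt ℝ q ρ := hq.differentiable one_ne_zero ρ
  have hne := eventually_ne_of_injective_fderiv hd
    (injective_fderiv_of_poissonBracket_conj_ne_zero hd (hbr ρ hzero)) 0
  obtain ⟨σ, hσ, hσ'⟩ := (hfreq.and_eventually hne).exists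
  exact hσ' hσ.2
end

section
/- Let q : ℝ² → ℂ be C¹ with q(x + 2π, ξ) = q(x, ξ) for all (x, ξ). Assume there exist N ∈ ℕ, a continuous 2π-periodic nonvanishing function a : ℝ → ℂ, and C > 0 such that |q(x, ξ) − a(x) ξ^N| ≤ C (1 + |ξ|)^{N−1} for all (x, ξ), and that {q, q̄}(ρ) ≠ 0 at every zero ρ of q. Then the number of points ρ ∈ [0, 2π) × ℝ with q(ρ) = 0 and (1/2i){q, q̄}(ρ) > 0 equals the number of points ρ ∈ [0, 2π) × ℝ with q(ρ) = 0 and (1/2i){q, q̄}(ρ) < 0. -/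
open Complex
open scoped Real ComplexOrder

/-- A `2π`-periodic loop `f : ℝ → ℂ` avoiding the origin has winding number `k`: it has a continuous
logarithm which increases by `2πik` over a period. -/
def HasWinding (f : ℝ → ℂ) (k : ℤ) : Prop :=
  ∃ g : ℝ → ℂ, Continuous g ∧ (∀ x, f x = exp (g x)) ∧
    ∀ x, g (x + 2 * π) = g x + k * (2 * π * I)

theorem eq_of_forall_exp_eq {X : Type*} [TopologicalSpace X] [PreconnectedSpace X] {h : X → ℂ}
    (hc : Continuous h) {w : ℂ} (hh : ∀ x, exp (h x) = w) (x y : X) : h x = h y := by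
  have := isCoveringMap_exp.eq_of_comp_eq hc (continuous_const (y := h y))
    (by ext z; simp [hh]) y rfl
  exact congrFun this x

theorem exists_continuous_log {X : Type*} [TopologicalSpace X] [SimplyConnectedSpace X]
    [LocallyPathConnectedSpace X] {f : X → ℂ} (hf : Continuous f) (h0 : ∀ x, f x ≠ 0) :
    ∃ g : X → ℂ, Continuous g ∧ ∀ x, f x = exp (g x) := by
  obtain ⟨x₀⟩ : Nonempty X := inferInstance
  obtain ⟨g, ⟨-, hg⟩, -⟩ := isCoveringMapOn_exp.existsUnique_continuousMap_lifts
    (⟨f, hf⟩ : C(X, ℂ)) (a₀ := x₀) (e₀ := log (f x₀)) (exp_log (h0 x₀)) (fun x => h0 x)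
  exact ⟨g, g.continuous, fun x => (congrFun hg x).symm⟩

theorem HasWinding.unique {f : ℝ → ℂ} {k l : ℤ} (hk : HasWinding f k) (hl : HasWinding f l) :
    k = l := by
  obtain ⟨g, hg, hfg, hgk⟩ := hk
  obtain ⟨g', hg', hfg', hgl⟩ := hl
  have h := eq_of_forall_exp_eq (hg.sub hg') (w := 1)
    (fun x => by rw [Pi.sub_apply, exp_sub, ← hfg, ← hfg', div_self]; rw [hfg]; exact exp_ne_zero _)
    (0 + 2 * π) 0
  simp only [Pi.sub_apply] at h
  rw [hgk, hgl] at h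
  have h2 : ((k : ℂ) - l) * (2 * π * I) = 0 := by linear_combination h
  have h3 := (mul_eq_zero.1 h2).resolve_right two_pi_I_ne_zero
  exact_mod_cast sub_eq_zero.1 h3

theorem HasWinding.mul {f f' : ℝ → ℂ} {k l : ℤ} (hk : HasWinding f k) (hl : HasWinding f' l) :
    HasWinding (fun x => f x * f' x) (k + l) := by
  obtain ⟨g, hg, hfg, hgk⟩ := hk
  obtain ⟨g', hg', hfg', hgl⟩ := hl
  refine ⟨fun x => g x + g' x, hg.add hg', fun x => by simp only [hfg, hfg', exp_add], fun x => ?_⟩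
  simp only [hgk, hgl]; push_cast; ring

theorem HasWinding.prod {ι : Type*} (s : Finset ι) {f : ι → ℝ → ℂ} {k : ι → ℤ}
    (h : ∀ i ∈ s, HasWinding (f i) (k i)) :
    HasWinding (fun x => ∏ i ∈ s, f i x) (∑ i ∈ s, k i) := by
  classical
  induction s using Finset.induction_on with
  | empty => exact ⟨fun _ => 0, continuous_const, by simp, by simp⟩
  | insert i s hi ih =>
    simp only [Finset.prod_insert hi, Finset.sum_insert hi]
    exact (h i (by simp)).mul (ih fun j hj => h j (by simp [hj]))

theorem HasWinding.conj {f : ℝ → ℂ} {k : ℤ} (hk : HasWinding f k) :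
    HasWinding (fun x => starRingEnd ℂ (f x)) (-k) := by
  obtain ⟨g, hg, hfg, hgk⟩ := hk
  refine ⟨fun x => starRingEnd ℂ (g x), continuous_conj.comp hg, fun x => by simp only [hfg, exp_conj],
    fun x => ?_⟩
  simp [hgk, map_ofNat]

theorem hasWinding_const {c : ℂ} (hc : c ≠ 0) : HasWinding (fun _ => c) 0 :=
  ⟨fun _ => log c, continuous_const, fun _ => (exp_log hc).symm, by simp⟩

theorem hasWinding_exp : HasWinding (fun x => exp (I * x)) 1 :=
  ⟨fun x => I * x, by fun_prop, fun _ => rfl, fun x => by push_cast; ring⟩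

theorem hasWinding_zero_of_norm_sub_one_lt {f : ℝ → ℂ} (hf : Continuous f)
    (hper : ∀ x, f (x + 2 * π) = f x) (h1 : ∀ x, ‖f x - 1‖ < 1) : HasWinding f 0 := by
  have hs : ∀ x, f x ∈ slitPlane := fun x => by
    left
    have := (abs_re_le_norm (f x - 1)).trans_lt (h1 x)
    rw [sub_re, one_re, abs_lt] at this
    linarith
  exact ⟨fun x => log (f x), hf.clog hs, fun x => (exp_log (slitPlane_ne_zero (hs x))).symm,
    fun x => by simp [hper]⟩

theorem exists_hasWinding {F : ℝ × ℝ → ℂ} (hF : Continuous F) (h0 : ∀ ρ, F ρ ≠ 0)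
    (hper : ∀ x ξ : ℝ, F (x + 2 * π, ξ) = F (x, ξ)) :
    ∃ k : ℤ, ∀ ξ, HasWinding (fun x => F (x, ξ)) k := by
  obtain ⟨g, hg, hFg⟩ := exists_continuous_log hF h0
  have hc := eq_of_forall_exp_eq (h := fun ρ : ℝ × ℝ => g (ρ.1 + 2 * π, ρ.2) - g ρ) (w := 1)
    (by fun_prop) (fun ρ => by rw [exp_sub, ← hFg, ← hFg, hper, div_self (h0 _)])
  have h1 : exp (g (0 + 2 * π, 0) - g (0, 0)) = 1 := by
    rw [exp_sub, ← hFg, ← hFg, hper, div_self (h0 _)]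
  obtain ⟨k, hk⟩ := exp_eq_one_iff.1 h1
  refine ⟨k, fun ξ => ⟨fun x => g (x, ξ), by fun_prop, fun x => hFg _, fun x => ?_⟩⟩
  rw [← hk, ← hc (x, ξ) (0, 0)]; ring

/-- The linear isomorphism `(x, ξ) ↦ i (x + iξ)`. -/
noncomputable def rotCLM : ℝ × ℝ →L[ℝ] ℂ :=
  I • ofRealCLM.comp (ContinuousLinearMap.fst ℝ ℝ ℝ) -
    ofRealCLM.comp (ContinuousLinearMap.snd ℝ ℝ ℝ)

@[simp]
theorem rotCLM_apply (v : ℝ × ℝ) : rotCLM v = I * v.1 - v.2 := by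
  simp [rotCLM]

/-- The function `1 - exp (i (z - z₀))` of `z = x + iξ`, which is `2π`-periodic in `x` and vanishes
simply at the translates of `z₀` and nowhere else. -/
noncomputable def cylFactor (ρ₀ ρ : ℝ × ℝ) : ℂ := 1 - exp (rotCLM (ρ - ρ₀))

theorem continuous_cylFactor (ρ₀ : ℝ × ℝ) : Continuous (cylFactor ρ₀) := by
  unfold cylFactor; fun_prop

@[simp]
theorem cylFactor_self (ρ₀ : ℝ × ℝ) : cylFactor ρ₀ ρ₀ = 0 := by
  simp [cylFactor]

theorem hasFDerivAt_cylFactor (ρ₀ : ℝ × ℝ) : HasFDerivAt (cylFactor ρ₀) (-rotCLM) ρ₀ := by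
  have h1 : HasFDerivAt (fun ρ => rotCLM (ρ - ρ₀)) rotCLM ρ₀ := by
    exact rotCLM.hasFDerivAt.comp ρ₀ ((hasFDerivAt_id ρ₀).sub_const ρ₀)
  have h2 := h1.cexp.const_sub 1
  rwa [sub_self, map_zero, exp_zero, one_smul] at h2

theorem cylFactor_add_int (ρ₀ : ℝ × ℝ) (x ξ : ℝ) (k : ℤ) :
    cylFactor ρ₀ (x + k * (2 * π), ξ) = cylFactor ρ₀ (x, ξ) := by
  have : rotCLM ((x + k * (2 * π), ξ) - ρ₀) = rotCLM ((x, ξ) - ρ₀) + k * (2 * π * I) := by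
    simp; ring
  rw [cylFactor, this, exp_add, exp_int_mul_two_pi_mul_I, mul_one, cylFactor]

theorem norm_exp_rotCLM (v : ℝ × ℝ) : ‖exp (rotCLM v)‖ = Real.exp (-v.2) := by
  simp [norm_exp]

theorem exists_add_int_of_cylFactor_eq_zero {ρ₀ ρ : ℝ × ℝ} (h : cylFactor ρ₀ ρ = 0) :
    ∃ k : ℤ, ρ = (ρ₀.1 + k * (2 * π), ρ₀.2) := by
  obtain ⟨k, hk⟩ := exp_eq_one_iff.1 (sub_eq_zero.1 h).symm
  refine ⟨k, Prod.ext ?_ ?_⟩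
  · have := congrArg im hk
    simp at this
    linarith
  · have := congrArg re hk
    simp at this
    simp; linarith

theorem eventually_exists_add_int_mem {ρ₀ : ℝ × ℝ} {U : Set (ℝ × ℝ)} (hU : U ∈ nhds ρ₀) :
    ∀ᶠ δ in nhdsWithin (0 : ℝ) (Set.Ioi 0), ∀ ρ : ℝ × ℝ, ‖cylFactor ρ₀ ρ‖ < δ →
      ∃ k : ℤ, (ρ.1 + k * (2 * π), ρ.2) ∈ U := by
  have hψ : ContinuousAt (fun u : ℂ => (ρ₀.1 + (log u).im, ρ₀.2 - (log u).re)) 1 := by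
    have h := continuousAt_clog one_mem_slitPlane
    exact (continuousAt_const.add (continuous_im.continuousAt.comp h)).prodMk
      (continuousAt_const.sub (continuous_re.continuousAt.comp h))
  have hU' : U ∈ nhds ((fun u : ℂ => (ρ₀.1 + (log u).im, ρ₀.2 - (log u).re)) 1) := by simpa using hU
  obtain ⟨ε, hε, hball⟩ := Metric.mem_nhds_iff.1 (hψ hU')
  filter_upwards [Ioo_mem_nhdsGT hε] with δ hδ ρ hρ
  have hmem := hball (a := exp (rotCLM (ρ - ρ₀)))
    (by rw [Metric.mem_ball, dist_comm, dist_eq]; exact hρ.trans hδ.2)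
  obtain ⟨k, hk⟩ := exp_eq_exp_iff_exists_int.1 (exp_log (exp_ne_zero (rotCLM (ρ - ρ₀))))
  refine ⟨k, ?_⟩
  have h1 := congrArg im hk
  have h2 := congrArg re hk
  simp only [Set.mem_preimage, h1, h2] at hmem
  convert hmem using 2
  · simp; ring
  · simp

theorem le_re_mul_conj (α β w : ℂ) :
    ‖α‖ * (‖α‖ - ‖β‖) * ‖w‖ ^ 2 ≤
      ((α * w + β * starRingEnd ℂ w) * starRingEnd ℂ w * starRingEnd ℂ α).re := by
  have h1 : (α * w + β * starRingEnd ℂ w) * starRingEnd ℂ w * starRingEnd ℂ α =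
      ((‖α‖ ^ 2 * ‖w‖ ^ 2 : ℝ) : ℂ) + β * starRingEnd ℂ w * starRingEnd ℂ w * starRingEnd ℂ α := by
    push_cast
    rw [← mul_conj', ← mul_conj']; ring
  have h2 := neg_le_of_abs_le
    (abs_re_le_norm (β * starRingEnd ℂ w * starRingEnd ℂ w * starRingEnd ℂ α))
  simp only [norm_mul, norm_conj] at h2
  rw [h1, add_re, ofReal_re]
  nlinarith

theorem norm_sq_le_norm_add_mul_I_sq (v : ℝ × ℝ) : ‖v‖ ^ 2 ≤ ‖(v.1 + v.2 * I : ℂ)‖ ^ 2 := by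
  gcongr
  rw [Prod.norm_def]
  refine max_le ?_ ?_
  · simpa using abs_re_le_norm (v.1 + v.2 * I : ℂ)
  · simpa using abs_im_le_norm (v.1 + v.2 * I : ℂ)

theorem apply_eq_add_conj (L : ℝ × ℝ →L[ℝ] ℂ) (v : ℝ × ℝ) :
    L v = (L (1, 0) - I * L (0, 1)) / 2 * (v.1 + v.2 * I) +
      (L (1, 0) + I * L (0, 1)) / 2 * starRingEnd ℂ (v.1 + v.2 * I) := by
  have h : v = v.1 • ((1, 0) : ℝ × ℝ) + v.2 • ((0, 1) : ℝ × ℝ) := by simp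
  conv_lhs => rw [h, map_add, map_smul, map_smul]
  simp
  linear_combination ((v.2 : ℂ) * L (0, 1)) * I_sq

theorem norm_sq_sub_norm_sq (A B : ℂ) :
    ‖(A - I * B) / 2‖ ^ 2 - ‖(A + I * B) / 2‖ ^ 2 = (B * starRingEnd ℂ A).im := by
  rw [← normSq_eq_norm_sq, ← normSq_eq_norm_sq]
  simp [normSq_apply]
  ring

theorem exists_le_re_of_pos (L : ℝ × ℝ →L[ℝ] ℂ)
    (hJ : 0 < (L (0, 1) * starRingEnd ℂ (L (1, 0))).im) :
    ∃ γ : ℂ, γ ≠ 0 ∧ ∃ c > 0, ∀ v, c * ‖v‖ ^ 2 ≤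
      (L v * starRingEnd ℂ ((-rotCLM) v) * γ).re := by
  have hn := norm_sq_sub_norm_sq (L (1, 0)) (L (0, 1))
  have hL := apply_eq_add_conj L
  set α := (L (1, 0) - I * L (0, 1)) / 2
  set β := (L (1, 0) + I * L (0, 1)) / 2
  have hlt : ‖β‖ < ‖α‖ := lt_of_pow_lt_pow_left₀ 2 (norm_nonneg _) (by linarith)
  have hα : 0 < ‖α‖ := (norm_nonneg _).trans_lt hlt
  refine ⟨-I * starRingEnd ℂ α, by simpa using norm_pos_iff.1 hα, ‖α‖ * (‖α‖ - ‖β‖),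
    mul_pos hα (sub_pos.2 hlt), fun v => ?_⟩
  calc _ ≤ ‖α‖ * (‖α‖ - ‖β‖) * ‖(v.1 + v.2 * I : ℂ)‖ ^ 2 :=
        mul_le_mul_of_nonneg_left (norm_sq_le_norm_add_mul_I_sq v)
          (mul_pos hα (sub_pos.2 hlt)).le
    _ ≤ _ := le_re_mul_conj α β _
    _ = _ := by
      congr 1
      rw [hL v]
      simp
      clear_value α β
      linear_combination ((α * (v.1 + v.2 * I) + β * (v.1 - v.2 * I)) *
        v.1 * starRingEnd ℂ α) * I_sq

theorem exists_le_re_of_neg (L : ℝ × ℝ →L[ℝ] ℂ)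
    (hJ : (L (0, 1) * starRingEnd ℂ (L (1, 0))).im < 0) :
    ∃ γ : ℂ, γ ≠ 0 ∧ ∃ c > 0, ∀ v, c * ‖v‖ ^ 2 ≤ (L v * (-rotCLM) v * γ).re := by
  have hn := norm_sq_sub_norm_sq (L (1, 0)) (L (0, 1))
  have hL := apply_eq_add_conj L
  set α := (L (1, 0) - I * L (0, 1)) / 2
  set β := (L (1, 0) + I * L (0, 1)) / 2
  have hlt : ‖α‖ < ‖β‖ := lt_of_pow_lt_pow_left₀ 2 (norm_nonneg _) (by linarith)
  have hβ : 0 < ‖β‖ := (norm_nonneg _).trans_lt hlt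
  refine ⟨I * starRingEnd ℂ β, by simpa using norm_pos_iff.1 hβ, ‖β‖ * (‖β‖ - ‖α‖),
    mul_pos hβ (sub_pos.2 hlt), fun v => ?_⟩
  calc _ ≤ ‖β‖ * (‖β‖ - ‖α‖) * ‖starRingEnd ℂ (v.1 + v.2 * I : ℂ)‖ ^ 2 := by
        rw [norm_conj]
        exact mul_le_mul_of_nonneg_left (norm_sq_le_norm_add_mul_I_sq v)
          (mul_pos hβ (sub_pos.2 hlt)).le
    _ ≤ _ := le_re_mul_conj β α _
    _ = _ := by
      congr 1
      rw [hL v]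
      simp
      ring_nf
      simp
      ring

open Asymptotics in
theorem eventually_re_pos {f m G : ℝ × ℝ → ℂ} {L l : ℝ × ℝ →L[ℝ] ℂ} {ρ₀ : ℝ × ℝ}
    (hf : HasFDerivAt f L ρ₀) (hf0 : f ρ₀ = 0) (hm : HasFDerivAt m l ρ₀) (hm0 : m ρ₀ = 0)
    (hG : ContinuousAt G ρ₀) (hG0 : G ρ₀ ≠ 0)
    (hγ : ∃ γ : ℂ, γ ≠ 0 ∧ ∃ c > 0, ∀ v, c * ‖v‖ ^ 2 ≤ (L v * l v * γ).re) :
    ∃ α : ℂ, α ≠ 0 ∧ ∀ᶠ ρ in nhds ρ₀, ρ ≠ ρ₀ → 0 < (f ρ * m ρ * G ρ * α).re := by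
  obtain ⟨γ, hγ0, c, hc, hq⟩ := hγ
  refine ⟨starRingEnd ℂ (G ρ₀) * γ, by simp [hG0, hγ0], ?_⟩
  have h1 : (fun ρ => f ρ - L (ρ - ρ₀)) =o[nhds ρ₀] fun ρ => ρ - ρ₀ := by
    simpa [hf0] using hf.isLittleO
  have h2 : (fun ρ => m ρ - l (ρ - ρ₀)) =o[nhds ρ₀] fun ρ => ρ - ρ₀ := by
    simpa [hm0] using hm.isLittleO
  have h1' : f =O[nhds ρ₀] fun ρ => ρ - ρ₀ := by simpa [hf0] using hf.isBigO_sub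
  have h2' : m =O[nhds ρ₀] fun ρ => ρ - ρ₀ := by simpa [hm0] using hm.isBigO_sub
  have hL : (fun ρ => L (ρ - ρ₀)) =O[nhds ρ₀] fun ρ => ρ - ρ₀ := L.isBigO_sub _ _
  have hG1 : (fun ρ => G ρ - G ρ₀) =o[nhds ρ₀] fun _ => (1 : ℝ) :=
    (isLittleO_one_iff ℝ).2 (by simpa using hG.sub_const (G ρ₀))
  have h3 : (fun ρ => f ρ * m ρ * G ρ - L (ρ - ρ₀) * l (ρ - ρ₀) * G ρ₀)
      =o[nhds ρ₀] fun ρ => ‖ρ - ρ₀‖ * ‖ρ - ρ₀‖ := by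
    have e1 := (h1.norm_right.mul_isBigO h2'.norm_right).mul_isBigO
      (isBigO_refl (fun _ => G ρ₀) (nhds ρ₀) |>.trans (isBigO_const_const _ one_ne_zero _ :
        _ =O[nhds ρ₀] fun _ => (1 : ℝ)))
    have e2 := (hL.norm_right.mul_isLittleO h2.norm_right).mul_isBigO
      (isBigO_refl (fun _ => G ρ₀) (nhds ρ₀) |>.trans (isBigO_const_const _ one_ne_zero _ :
        _ =O[nhds ρ₀] fun _ => (1 : ℝ)))
    have e3 := (h1'.norm_right.mul h2'.norm_right).mul_isLittleO hG1
    refine ((e1.add e2).add e3).congr (fun ρ => ?_) (fun ρ => by ring)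
    ring
  have hcpos : 0 < c * ‖G ρ₀‖ ^ 2 := by positivity
  have h4 := (h3.mul_isBigO (isBigO_const_const (starRingEnd ℂ (G ρ₀) * γ)
    (one_ne_zero (α := ℝ)) (nhds ρ₀))).def (half_pos hcpos)
  filter_upwards [h4] with ρ hρ hne
  have hv : 0 < ‖ρ - ρ₀‖ := norm_pos_iff.2 (sub_ne_zero.2 hne)
  have h5 := neg_le_of_abs_le ((abs_re_le_norm _).trans hρ)
  have h6 : ((f ρ * m ρ * G ρ - L (ρ - ρ₀) * l (ρ - ρ₀) * G ρ₀) *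
      (starRingEnd ℂ (G ρ₀) * γ)).re = (f ρ * m ρ * G ρ * (starRingEnd ℂ (G ρ₀) * γ)).re -
        ‖G ρ₀‖ ^ 2 * (L (ρ - ρ₀) * l (ρ - ρ₀) * γ).re := by
    rw [← re_ofReal_mul, ← sub_re]
    congr 1
    push_cast
    rw [← mul_conj']; ring
  rw [h6] at h5
  have h7 := mul_le_mul_of_nonneg_left (hq (ρ - ρ₀)) (sq_nonneg ‖G ρ₀‖)
  have h8 : 0 < c * ‖G ρ₀‖ ^ 2 * ‖ρ - ρ₀‖ ^ 2 := by positivity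
  simp only [mul_one, norm_mul, norm_norm] at h5
  nlinarith

theorem HasWinding.of_norm_sub_lt {f h : ℝ → ℂ} {k : ℤ} (hf : HasWinding f k) (hh : Continuous h)
    (hper : ∀ x, h (x + 2 * π) = h x) (hlt : ∀ x, ‖h x - f x‖ < ‖f x‖) : HasWinding h k := by
  have hf' := hf
  obtain ⟨g, hg, hfg, hgk⟩ := hf'
  have hf0 : ∀ x, f x ≠ 0 := fun x => by rw [hfg]; exact exp_ne_zero _
  have hfc : Continuous f := by
    rw [show f = fun x => exp (g x) from funext hfg]; fun_prop
  have hfper : ∀ x, f (x + 2 * π) = f x := fun x => by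
    rw [hfg, hgk, exp_add, exp_int_mul_two_pi_mul_I, mul_one, hfg]
  have h1 : HasWinding (fun x => h x / f x) 0 := by
    refine hasWinding_zero_of_norm_sub_one_lt (hh.div hfc hf0) (fun x => by rw [hper, hfper])
      fun x => ?_
    rw [div_sub_one (hf0 x), norm_div, div_lt_one (norm_pos_iff.2 (hf0 x))]
    exact hlt x
  have h2 := hf.mul h1
  simp only [mul_div_cancel₀ _ (hf0 _), add_zero] at h2
  exact h2

theorem cylFactor_add_two_pi (ρ₀ : ℝ × ℝ) (x ξ : ℝ) :
    cylFactor ρ₀ (x + 2 * π, ξ) = cylFactor ρ₀ (x, ξ) := by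
  simpa using cylFactor_add_int ρ₀ x ξ 1

theorem hasWinding_cylFactor_of_lt {ρ₀ : ℝ × ℝ} {ξ : ℝ} (h : ρ₀.2 < ξ) :
    HasWinding (fun x => cylFactor ρ₀ (x, ξ)) 0 := by
  have := continuous_cylFactor ρ₀
  refine hasWinding_zero_of_norm_sub_one_lt (by fun_prop)
    (fun x => cylFactor_add_two_pi ρ₀ x ξ) fun x => ?_
  rw [cylFactor, sub_sub_cancel_left, norm_neg, norm_exp_rotCLM]
  simpa using h

theorem hasWinding_cylFactor_of_gt {ρ₀ : ℝ × ℝ} {ξ : ℝ} (h : ξ < ρ₀.2) :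
    HasWinding (fun x => cylFactor ρ₀ (x, ξ)) 1 := by
  have := continuous_cylFactor ρ₀
  have h1 : HasWinding (fun x : ℝ => -exp (rotCLM ((x, ξ) - ρ₀))) 1 := by
    have h2 := (hasWinding_const (c := -exp (rotCLM ((0, ξ) - ρ₀)))
      (neg_ne_zero.2 (exp_ne_zero _))).mul hasWinding_exp
    simp only [zero_add, neg_mul, ← exp_add] at h2
    refine (congrArg (HasWinding · 1) (funext fun x => ?_)).mpr h2
    congr 2
    simp; ring
  refine h1.of_norm_sub_lt (by fun_prop) (fun x => cylFactor_add_two_pi ρ₀ x ξ) fun x => ?_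
  rw [cylFactor, sub_neg_eq_add, sub_add_cancel, norm_neg, norm_exp_rotCLM]
  simpa using h

theorem half_le_norm_cylFactor {ρ₀ ρ : ℝ × ℝ} (h : 1 ≤ |ρ.2 - ρ₀.2|) :
    1 / 2 ≤ ‖cylFactor ρ₀ ρ‖ := by
  have h1 := abs_norm_sub_norm_le (1 : ℂ) (exp (rotCLM (ρ - ρ₀)))
  rw [norm_exp_rotCLM, norm_one, Prod.snd_sub] at h1
  refine le_trans ?_ h1
  rcases le_abs.1 h with h2 | h2
  · have h3 := Real.add_one_le_exp (ρ.2 - ρ₀.2)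
    have h4 : Real.exp (ρ.2 - ρ₀.2) * Real.exp (-(ρ.2 - ρ₀.2)) = 1 := by
      rw [← Real.exp_add]; simp
    refine le_trans ?_ (le_abs_self _)
    nlinarith [Real.exp_pos (-(ρ.2 - ρ₀.2))]
  · have h3 := Real.add_one_le_exp (-(ρ.2 - ρ₀.2))
    refine le_trans ?_ (neg_le_abs _)
    linarith

theorem exists_forall_norm_sub_lt {q : ℝ × ℝ → ℂ} {N : ℕ} {a : ℝ → ℂ} (ha : Continuous a)
    (hap : ∀ x, a (x + 2 * π) = a x) (ha0 : ∀ x, a x ≠ 0) {C : ℝ} (hC : 0 < C)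
    (hell : ∀ x ξ : ℝ, ‖q (x, ξ) - a x * (ξ : ℂ) ^ N‖ ≤ C * (1 + |ξ|) ^ ((N : ℝ) - 1)) :
    ∃ R : ℝ, 0 < R ∧ ∀ x ξ : ℝ, R ≤ |ξ| →
      ‖q (x, ξ) - a x * (ξ : ℂ) ^ N‖ < ‖a x * (ξ : ℂ) ^ N‖ := by
  have hcomp : IsCompact (Set.range fun x => ‖a x‖) :=
    Function.Periodic.compact_of_continuous (c := 2 * π) (fun x => by simp only [hap])
      (by positivity) ha.norm
  obtain ⟨_, ⟨x₀, rfl⟩, hmin⟩ := hcomp.exists_isLeast (Set.range_nonempty _)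
  have hm : 0 < ‖a x₀‖ := norm_pos_iff.2 (ha0 x₀)
  refine ⟨1 + C * 2 ^ N / ‖a x₀‖, by positivity, fun x ξ hξ => (hell x ξ).trans_lt ?_⟩
  have hle : ‖a x₀‖ ≤ ‖a x‖ := hmin ⟨x, rfl⟩
  rw [norm_mul, norm_pow, norm_real, Real.norm_eq_abs]
  set t := |ξ|
  have hpos : 0 < C * 2 ^ N / ‖a x₀‖ := by positivity
  have ht : 1 ≤ t := by linarith
  have h1 : C * 2 ^ N < ‖a x₀‖ * (1 + t) := by
    rw [← div_lt_iff₀' hm]; linarith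
  rw [Real.rpow_sub_one (by positivity), Real.rpow_natCast, ← mul_div_assoc,
    div_lt_iff₀ (by positivity)]
  calc C * (1 + t) ^ N ≤ C * (2 * t) ^ N := by gcongr; linarith
    _ = C * 2 ^ N * t ^ N := by rw [mul_pow]; ring
    _ < ‖a x₀‖ * (1 + t) * t ^ N := by gcongr
    _ = ‖a x₀‖ * t ^ N * (1 + t) := by ring
    _ ≤ _ := by gcongr

/-- The Jacobian determinant of `q`, viewed as a map `ℝ² → ℝ²`. -/
noncomputable def jacobian (q : ℝ × ℝ → ℂ) (ρ : ℝ × ℝ) : ℝ :=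
  (fderiv ℝ q ρ (0, 1) * starRingEnd ℂ (fderiv ℝ q ρ (1, 0))).im

theorem poissonBracket_conj {q : ℝ × ℝ → ℂ} {ρ : ℝ × ℝ} (hq : DifferentiableAt ℝ q ρ) :
    poissonBracket q (fun p => starRingEnd ℂ (q p)) ρ = 2 * I * jacobian q ρ := by
  have h : HasFDerivAt (fun p => starRingEnd ℂ (q p))
      ((conjCLE : ℂ →L[ℝ] ℂ).comp (fderiv ℝ q ρ)) ρ :=
    (conjCLE : ℂ →L[ℝ] ℂ).hasFDerivAt.comp ρ hq.hasFDerivAt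
  rw [poissonBracket, h.fderiv, jacobian]
  apply Complex.ext <;> simp <;> ring

open Classical in
/-- A function with the same zeros as `cylFactor ρ₀`, whose product with `q` behaves like
a nonvanishing multiple of `|z - z₀|²` up to an angle less than `π / 2` near the zero `z₀`. -/
noncomputable def zeroFactor (q : ℝ × ℝ → ℂ) (ρ₀ ρ : ℝ × ℝ) : ℂ :=
  if 0 < jacobian q ρ₀ then starRingEnd ℂ (cylFactor ρ₀ ρ) else cylFactor ρ₀ ρ

theorem continuous_zeroFactor (q : ℝ × ℝ → ℂ) (ρ₀ : ℝ × ℝ) : Continuous (zeroFactor q ρ₀) := by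
  unfold zeroFactor
  split_ifs
  · exact continuous_conj.comp (continuous_cylFactor ρ₀)
  · exact continuous_cylFactor ρ₀

theorem zeroFactor_eq_zero_iff {q : ℝ × ℝ → ℂ} {ρ₀ ρ : ℝ × ℝ} :
    zeroFactor q ρ₀ ρ = 0 ↔ cylFactor ρ₀ ρ = 0 := by
  unfold zeroFactor
  split_ifs <;> simp

theorem zeroFactor_add_int (q : ℝ × ℝ → ℂ) (ρ₀ : ℝ × ℝ) (x ξ : ℝ) (k : ℤ) :
    zeroFactor q ρ₀ (x + k * (2 * π), ξ) = zeroFactor q ρ₀ (x, ξ) := by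
  simp only [zeroFactor, cylFactor_add_int]

theorem hasWinding_zeroFactor_of_lt (q : ℝ × ℝ → ℂ) {ρ₀ : ℝ × ℝ} {ξ : ℝ} (h : ρ₀.2 < ξ) :
    HasWinding (fun x => zeroFactor q ρ₀ (x, ξ)) 0 := by
  unfold zeroFactor
  split_ifs
  · simpa using (hasWinding_cylFactor_of_lt h).conj
  · exact hasWinding_cylFactor_of_lt h

open Classical in
theorem hasWinding_zeroFactor_of_gt (q : ℝ × ℝ → ℂ) {ρ₀ : ℝ × ℝ} {ξ : ℝ} (h : ξ < ρ₀.2) :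
    HasWinding (fun x => zeroFactor q ρ₀ (x, ξ)) (if 0 < jacobian q ρ₀ then -1 else 1) := by
  unfold zeroFactor
  split_ifs
  · exact (hasWinding_cylFactor_of_gt h).conj
  · exact hasWinding_cylFactor_of_gt h

theorem exists_eventually_re_pos {q G : ℝ × ℝ → ℂ} {ρ₀ : ℝ × ℝ} (hq : DifferentiableAt ℝ q ρ₀)
    (h0 : q ρ₀ = 0) (hJ : jacobian q ρ₀ ≠ 0) (hG : ContinuousAt G ρ₀) (hG0 : G ρ₀ ≠ 0) :
    ∃ α : ℂ, α ≠ 0 ∧ ∀ᶠ ρ in nhds ρ₀, ρ ≠ ρ₀ →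
      0 < (q ρ * zeroFactor q ρ₀ ρ * G ρ * α).re := by
  have hm := hasFDerivAt_cylFactor ρ₀
  rcases hJ.lt_or_gt with hJ | hJ
  · have := eventually_re_pos hq.hasFDerivAt h0 hm (cylFactor_self ρ₀) hG hG0
      (exists_le_re_of_neg _ hJ)
    simpa only [zeroFactor, if_neg hJ.not_gt] using this
  · have hm' : HasFDerivAt (fun ρ => starRingEnd ℂ (cylFactor ρ₀ ρ))
        ((conjCLE : ℂ →L[ℝ] ℂ).comp (-rotCLM)) ρ₀ :=
      (conjCLE : ℂ →L[ℝ] ℂ).hasFDerivAt.comp ρ₀ hm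
    have := eventually_re_pos hq.hasFDerivAt h0 hm' (by simp) hG hG0 (exists_le_re_of_pos _ hJ)
    simpa only [zeroFactor, if_pos hJ] using this

theorem finite_of_jacobian_ne_zero {q : ℝ × ℝ → ℂ} (hq : ContDiff ℝ 1 q)
    (hJ : ∀ ρ, q ρ = 0 → jacobian q ρ ≠ 0) {K : Set (ℝ × ℝ)} (hK : IsCompact K) :
    {ρ | ρ ∈ K ∧ q ρ = 0}.Finite := by
  by_contra hinf
  have hcomp : IsCompact {ρ | ρ ∈ K ∧ q ρ = 0} :=
    hK.inter_right (isClosed_singleton.preimage hq.continuous (t := {0}))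
  obtain ⟨ρ₀, hρ₀, hacc⟩ :=
    Set.Infinite.exists_accPt_of_subset_isCompact hinf hcomp subset_rfl
  obtain ⟨α, -, hα⟩ := exists_eventually_re_pos (G := fun _ => 1)
    (hq.differentiable one_ne_zero ρ₀) hρ₀.2 (hJ _ hρ₀.2) continuousAt_const one_ne_zero
  obtain ⟨ρ, ⟨hne, hρ⟩, hpos⟩ := ((accPt_iff_frequently.1 hacc).and_eventually hα).exists
  simpa [hρ.2] using hpos hne

open Classical in
theorem sum_sign_eq_zero {q : ℝ × ℝ → ℂ} (hq : ContDiff ℝ 1 q)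
    (hper : ∀ x ξ : ℝ, q (x + 2 * π, ξ) = q (x, ξ)) {N : ℕ} {a : ℝ → ℂ} (ha : Continuous a)
    (hap : ∀ x, a (x + 2 * π) = a x) (ha0 : ∀ x, a x ≠ 0) {R : ℝ} (hR : 0 < R)
    (hell : ∀ x ξ : ℝ, R ≤ |ξ| → ‖q (x, ξ) - a x * (ξ : ℂ) ^ N‖ < ‖a x * (ξ : ℂ) ^ N‖)
    (hJ : ∀ ρ, q ρ = 0 → jacobian q ρ ≠ 0) (Z : Finset (ℝ × ℝ))
    (hZ : ∀ ρ, ρ ∈ Z ↔ ρ.1 ∈ Set.Ico 0 (2 * π) ∧ q ρ = 0) :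
    ∑ ρ ∈ Z, (if 0 < jacobian q ρ then -1 else 1 : ℤ) = 0 := by
  have hperk : ∀ (x ξ : ℝ) (k : ℤ), q (x + k * (2 * π), ξ) = q (x, ξ) := fun x ξ k =>
    Function.Periodic.int_mul (f := fun x => q (x, ξ)) (fun x => hper x ξ) k x
  -- zeros of the factors
  have hinj : ∀ j ∈ Z, ∀ k ∈ Z, cylFactor k j = 0 → j = k := by
    intro j hj k hk h
    obtain ⟨n, hn⟩ := exists_add_int_of_cylFactor_eq_zero h
    have h1 := ((hZ j).1 hj).1
    have h2 := ((hZ k).1 hk).1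
    have h3 : j.1 = k.1 + n * (2 * π) := congrArg Prod.fst hn
    have hpi : 0 < 2 * π := by positivity
    have h4 : (n : ℝ) < 1 := by
      by_contra! h
      nlinarith [h1.1, h1.2, h2.1, h2.2]
    have h5 : (-1 : ℝ) < n := by
      by_contra! h
      nlinarith [h1.1, h1.2, h2.1, h2.2]
    have h6 : n = 0 := by
      have : n < 1 := by exact_mod_cast h4
      have : -1 < n := by exact_mod_cast h5
      omega
    rw [hn, h6]; simp
  have hqzero : ∀ ρ, q ρ = 0 → ∃ j ∈ Z, cylFactor j ρ = 0 := by
    intro ρ hρ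
    have hpi : 0 < 2 * π := by positivity
    have hmem : toIcoMod hpi 0 ρ.1 ∈ Set.Ico 0 (2 * π) := by
      simpa using toIcoMod_mem_Ico hpi 0 ρ.1
    have hdiv := toIcoMod_add_toIcoDiv_zsmul hpi 0 ρ.1
    rw [zsmul_eq_mul] at hdiv
    generalize toIcoMod hpi 0 ρ.1 = x at hmem hdiv
    have hρx : ρ = (x + toIcoDiv hpi 0 ρ.1 * (2 * π), ρ.2) := Prod.ext hdiv.symm rfl
    refine ⟨(x, ρ.2), (hZ _).2 ⟨hmem, ?_⟩, ?_⟩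
    · rw [← hρ, ← hperk x ρ.2 (toIcoDiv hpi 0 ρ.1), ← hρx]
    · rw [← cylFactor_self (x, ρ.2), ← cylFactor_add_int (x, ρ.2) x ρ.2 (toIcoDiv hpi 0 ρ.1), ← hρx]
  have hcont := continuous_zeroFactor q
  have hcontc := continuous_cylFactor
  have hqc := hq.continuous
  set P : ℝ × ℝ → ℂ := fun ρ => ∏ j ∈ Z, zeroFactor q j ρ with hP
  have hPc : Continuous P := by fun_prop
  -- behaviour near each zero
  have hloc : ∀ j ∈ Z, ∃ α : ℂ, α ≠ 0 ∧ ∀ᶠ ρ in nhds j, ρ ≠ j → 0 < (q ρ * P ρ * α).re := by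
    intro j hj
    have hG0 : ∏ k ∈ Z.erase j, zeroFactor q k j ≠ 0 := by
      refine Finset.prod_ne_zero_iff.2 fun k hk h => ?_
      rw [Finset.mem_erase] at hk
      exact hk.1 (hinj j hj k hk.2 (zeroFactor_eq_zero_iff.1 h)).symm
    obtain ⟨α, hα, h⟩ := exists_eventually_re_pos
      (G := fun ρ => ∏ k ∈ Z.erase j, zeroFactor q k ρ) (hq.differentiable one_ne_zero j)
      ((hZ j).1 hj).2 (hJ j ((hZ j).1 hj).2) (by fun_prop) hG0
    refine ⟨α, hα, h.mono fun ρ hρ hne => ?_⟩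
    have := hρ hne
    rwa [mul_assoc (q ρ), Finset.mul_prod_erase Z (fun k => zeroFactor q k ρ) hj] at this
  choose! α hα0 hα using hloc
  -- choice of the radius of the bumps
  have hδ1 : ∀ᶠ δ in nhdsWithin (0 : ℝ) (Set.Ioi 0), ∀ j ∈ Z, ∀ ρ : ℝ × ℝ, ‖cylFactor j ρ‖ < δ →
      ∃ k : ℤ, (ρ.1 + k * (2 * π), ρ.2) ∈ {ρ | ρ ≠ j → 0 < (q ρ * P ρ * α j).re} :=
    (Filter.eventually_all_finset Z).2 fun j hj => eventually_exists_add_int_mem (hα j hj)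
  have hδ2 : ∀ᶠ δ in nhdsWithin (0 : ℝ) (Set.Ioi 0), ∀ j ∈ Z, ∀ k ∈ Z, j ≠ k → ∀ ρ : ℝ × ℝ,
      ‖cylFactor j ρ‖ < δ → δ ≤ ‖cylFactor k ρ‖ := by
    refine (Filter.eventually_all_finset Z).2 fun j hj =>
      (Filter.eventually_all_finset Z).2 fun k hk => ?_
    by_cases hjk : j = k
    · simp [hjk]
    have hpos : 0 < ‖cylFactor k j‖ := norm_pos_iff.2 fun h => hjk (hinj j hj k hk h)
    have hU : {ρ | ‖cylFactor k j‖ / 2 < ‖cylFactor k ρ‖} ∈ nhds j :=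
      (hcontc k).norm.continuousAt.eventually (lt_mem_nhds (half_lt_self hpos))
    filter_upwards [eventually_exists_add_int_mem hU, Ioo_mem_nhdsGT (half_pos hpos)]
      with δ hδ hδ' _ ρ hρ
    obtain ⟨n, hn⟩ := hδ ρ hρ
    rw [cylFactor_add_int] at hn
    exact (hδ'.2.trans hn).le
  have hδ3 : ∀ᶠ δ in nhdsWithin (0 : ℝ) (Set.Ioi 0), δ ∈ Set.Ioo (0 : ℝ) (1 / 2) :=
    Ioo_mem_nhdsGT (by norm_num)
  obtain ⟨δ, hδ1, hδ2, hδ0, hδ3⟩ := (hδ1.and (hδ2.and hδ3)).exists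
  set F : ℝ × ℝ → ℂ := fun ρ =>
    q ρ * P ρ + ∑ j ∈ Z, (max 0 (δ - ‖cylFactor j ρ‖) : ℝ) * starRingEnd ℂ (α j) with hF
  have hFc : Continuous F := by fun_prop
  have hPper : ∀ (x ξ : ℝ) (k : ℤ), P (x + k * (2 * π), ξ) = P (x, ξ) := fun x ξ k => by
    simp only [hP, zeroFactor_add_int]
  have hFper : ∀ x ξ : ℝ, F (x + 2 * π, ξ) = F (x, ξ) := fun x ξ => by
    have := hPper x ξ 1
    simp only [Int.cast_one, one_mul] at this
    simp only [hF, hper, this, cylFactor_add_two_pi]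
  have hF_far : ∀ ρ, (∀ j ∈ Z, δ ≤ ‖cylFactor j ρ‖) → F ρ = q ρ * P ρ := by
    intro ρ hρ
    simp only [hF]
    rw [Finset.sum_eq_zero, add_zero]
    intro j hj
    rw [max_eq_left (sub_nonpos.2 (hρ j hj))]; simp
  have hF0 : ∀ ρ, F ρ ≠ 0 := by
    intro ρ
    by_cases hfar : ∀ j ∈ Z, δ ≤ ‖cylFactor j ρ‖
    · have hne : ∀ j ∈ Z, cylFactor j ρ ≠ 0 := fun j hj h => by
        have := hfar j hj
        rw [h, norm_zero] at this
        linarith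
      rw [hF_far ρ hfar]
      refine mul_ne_zero (fun h => ?_) (Finset.prod_ne_zero_iff.2 fun j hj h =>
        hne j hj (zeroFactor_eq_zero_iff.1 h))
      obtain ⟨j, hj, h⟩ := hqzero ρ h
      exact hne j hj h
    · push Not at hfar
      obtain ⟨j, hj, hjδ⟩ := hfar
      have hFj : F ρ = q ρ * P ρ +
          ((δ - ‖cylFactor j ρ‖ : ℝ) : ℂ) * starRingEnd ℂ (α j) := by
        simp only [hF]
        rw [Finset.sum_eq_single_of_mem j hj, max_eq_right (sub_pos.2 hjδ).le]
        intro k hk hkj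
        rw [max_eq_left (sub_nonpos.2 (hδ2 j hj k hk hkj.symm ρ hjδ))]; simp
      have hre : (F ρ * α j).re = (q ρ * P ρ * α j).re +
          (δ - ‖cylFactor j ρ‖) * ‖α j‖ ^ 2 := by
        rw [hFj, add_mul, add_re, mul_assoc (ofReal _), conj_mul', ← ofReal_pow, ← ofReal_mul,
          ofReal_re]
      have hnn : 0 ≤ (q ρ * P ρ * α j).re := by
        obtain ⟨k, hk⟩ := hδ1 j hj ρ hjδ
        rw [Set.mem_ofPred_eq, hperk, hPper] at hk
        by_cases h : (ρ.1 + k * (2 * π), ρ.2) = j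
        · have : q ρ = 0 := by rw [← ((hZ j).1 hj).2, ← h, hperk]
          simp [this]
        · exact (hk h).le
      have hpos : 0 < (δ - ‖cylFactor j ρ‖) * ‖α j‖ ^ 2 :=
        mul_pos (sub_pos.2 hjδ) (pow_pos (norm_pos_iff.2 (hα0 j hj)) 2)
      intro h
      rw [h, zero_mul, zero_re] at hre
      linarith
  -- comparison of the winding numbers at both ends
  obtain ⟨k, hk⟩ := exists_hasWinding hFc hF0 hFper
  obtain ⟨m, hm⟩ := exists_hasWinding (F := fun ρ => a ρ.1) (by fun_prop) (fun ρ => ha0 _)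
    (fun x _ => hap x)
  have hqw : ∀ ξ : ℝ, R ≤ |ξ| → HasWinding (fun x => q (x, ξ)) m := by
    intro ξ hξ
    have hξ0 : (ξ : ℂ) ^ N ≠ 0 := pow_ne_zero _ (by
      rintro h
      rw [ofReal_eq_zero.1 h, abs_zero] at hξ
      linarith)
    have := (hm ξ).mul (hasWinding_const hξ0)
    rw [add_zero] at this
    exact this.of_norm_sub_lt (by fun_prop) (fun x => hper x ξ) fun x => hell x ξ hξ
  obtain ⟨T, hT, hTR⟩ := ((Filter.eventually_all_finset Z).2 fun j _ =>
    Filter.eventually_ge_atTop (1 + |j.2|)).and (Filter.eventually_ge_atTop R) |>.exists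
  have hfar : ∀ ξ : ℝ, |ξ| = T → ∀ x, F (x, ξ) = q (x, ξ) * P (x, ξ) := fun ξ hξ x =>
    hF_far _ fun j hj => hδ3.le.trans (half_le_norm_cylFactor (by
      have := abs_sub_abs_le_abs_sub ξ j.2
      have := hT j hj
      simp only
      linarith))
  have hTabs : |T| = T := abs_of_pos (hR.trans_le hTR)
  have htop : HasWinding (fun x => F (x, T)) (m + ∑ j ∈ Z, 0) := by
    simp only [hfar T hTabs]
    exact (hqw T (hTR.trans_eq hTabs.symm)).mul (HasWinding.prod Z fun j hj =>
      hasWinding_zeroFactor_of_lt q (by linarith [hT j hj, le_abs_self j.2]))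
  have hbot : HasWinding (fun x => F (x, -T))
      (m + ∑ j ∈ Z, (if 0 < jacobian q j then -1 else 1 : ℤ)) := by
    simp only [hfar (-T) ((abs_neg T).trans hTabs)]
    exact (hqw (-T) (hTR.trans_eq (by rw [abs_neg, hTabs]))).mul (HasWinding.prod Z fun j hj =>
      hasWinding_zeroFactor_of_gt q (by linarith [hT j hj, neg_abs_le j.2]))
  have h1 := htop.unique (hk T)
  have h2 := hbot.unique (hk (-T))
  simp only [Finset.sum_const_zero] at h1
  linarith

/-- under the ellipticity and nondegeneracy hypotheses on `q`, the number of
zeros of `q` in `[0, 2π) × ℝ` with `(1/2i){q, q̄} > 0` equals the number of zeros with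
`(1/2i){q, q̄} < 0`. -/
theorem card_zeros_pos_eq_card_zeros_neg
    (q : ℝ × ℝ → ℂ) (hq : ContDiff ℝ 1 q)
    (hper : ∀ x ξ : ℝ, q (x + 2 * Real.pi, ξ) = q (x, ξ))
    (N : ℕ) (a : ℝ → ℂ) (ha : Continuous a) (hap : ∀ x, a (x + 2 * Real.pi) = a x)
    (ha0 : ∀ x, a x ≠ 0) (C : ℝ) (hC : 0 < C)
    (hell : ∀ x ξ : ℝ, ‖q (x, ξ) - a x * (ξ : ℂ) ^ N‖ ≤ C * (1 + |ξ|) ^ ((N : ℝ) - 1))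
    (hbr : ∀ ρ : ℝ × ℝ, q ρ = 0 → poissonBracket q (fun p => starRingEnd ℂ (q p)) ρ ≠ 0) :
    Set.ncard {ρ : ℝ × ℝ | ρ.1 ∈ Set.Ico 0 (2 * Real.pi) ∧ q ρ = 0 ∧
        0 < 1 / (2 * Complex.I) * poissonBracket q (fun p => starRingEnd ℂ (q p)) ρ} =
      Set.ncard {ρ : ℝ × ℝ | ρ.1 ∈ Set.Ico 0 (2 * Real.pi) ∧ q ρ = 0 ∧
        1 / (2 * Complex.I) * poissonBracket q (fun p => starRingEnd ℂ (q p)) ρ < 0} := by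
  classical
  have hbr' : ∀ ρ, 1 / (2 * Complex.I) * poissonBracket q (fun p => starRingEnd ℂ (q p)) ρ =
      (jacobian q ρ : ℂ) := fun ρ => by
    rw [poissonBracket_conj (hq.differentiable one_ne_zero ρ), ← mul_assoc,
      one_div_mul_cancel (mul_ne_zero two_ne_zero I_ne_zero), one_mul]
  have hJ : ∀ ρ, q ρ = 0 → jacobian q ρ ≠ 0 := fun ρ hρ h => hbr ρ hρ (by
    rw [poissonBracket_conj (hq.differentiable one_ne_zero ρ), h]; simp)
  obtain ⟨R, hR, hlt⟩ := exists_forall_norm_sub_lt ha hap ha0 hC hell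
  have hfin : {ρ : ℝ × ℝ | ρ.1 ∈ Set.Ico 0 (2 * π) ∧ q ρ = 0}.Finite := by
    refine (finite_of_jacobian_ne_zero hq hJ
      (isCompact_Icc (a := ((0, -R) : ℝ × ℝ)) (b := (2 * π, R)))).subset fun ρ hρ => ⟨?_, hρ.2⟩
    have hb : |ρ.2| < R := by
      by_contra! h
      have := hlt ρ.1 ρ.2 h
      rw [Prod.mk.eta, hρ.2, zero_sub, norm_neg] at this
      exact lt_irrefl _ this
    exact ⟨⟨hρ.1.1, (abs_lt.1 hb).1.le⟩, ⟨hρ.1.2.le, (abs_lt.1 hb).2.le⟩⟩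
  have hZ : ∀ ρ, ρ ∈ hfin.toFinset ↔ ρ.1 ∈ Set.Ico 0 (2 * π) ∧ q ρ = 0 := fun ρ => by simp
  have hsum := sum_sign_eq_zero hq hper ha hap ha0 hR hlt hJ hfin.toFinset hZ
  rw [Finset.sum_ite] at hsum
  have hpos : {ρ : ℝ × ℝ | ρ.1 ∈ Set.Ico 0 (2 * π) ∧ q ρ = 0 ∧
      0 < 1 / (2 * Complex.I) * poissonBracket q (fun p => starRingEnd ℂ (q p)) ρ} =
      (hfin.toFinset.filter fun ρ => 0 < jacobian q ρ : Finset (ℝ × ℝ)) := by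
    ext ρ
    rw [Set.mem_ofPred_eq, hbr', Finset.mem_coe, Finset.mem_filter, hZ, zero_lt_real, and_assoc]
  have hneg : {ρ : ℝ × ℝ | ρ.1 ∈ Set.Ico 0 (2 * π) ∧ q ρ = 0 ∧
      1 / (2 * Complex.I) * poissonBracket q (fun p => starRingEnd ℂ (q p)) ρ < 0} =
      (hfin.toFinset.filter fun ρ => ¬ 0 < jacobian q ρ : Finset (ℝ × ℝ)) := by
    ext ρ
    rw [Set.mem_ofPred_eq, hbr', Finset.mem_coe, Finset.mem_filter, hZ, and_assoc, ← ofReal_zero,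
      real_lt_real, not_lt]
    exact and_congr_right fun _ => and_congr_right fun h =>
      ⟨le_of_lt, fun hle => lt_of_le_of_ne hle (hJ ρ h)⟩
  rw [hpos, hneg, Set.ncard_coe_finset, Set.ncard_coe_finset]
  simp only [Finset.sum_const, nsmul_eq_mul, mul_neg, mul_one] at hsum
  omega
end

section
/- Let C₀ ≥ 1 and let γ : [0, 1] → ℂ be twice continuously differentiable with 1/C₀ ≤ |γ'(t)| ≤ C₀ and |γ''(t)| ≤ C₀ for all t ∈ [0, 1]. Then there exists a constant C > 0, depending only on C₀, such that for every z ∈ ℂ and every r with 0 < r ≤ 1/(2C₀³), each connected component of the set { t ∈ [0, 1] : |γ(t) − z| ≤ r } is contained in an interval of length ≤ C·r; in particular the arc of γ over each such component has length ≤ C₀·C·r. -/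
open MeasureTheory

/-- First-order Taylor bound on `[s, t]` for a curve whose derivative has derivative bounded
by `K`. -/
lemma norm_sub_sub_smul_deriv_le {E : Type*} [NormedAddCommGroup E] [NormedSpace ℝ E]
    {f f' f'' : ℝ → E} {K s t : ℝ} (hst : s ≤ t)
    (hf : ∀ x ∈ Set.Icc s t, HasDerivWithinAt f (f' x) (Set.Icc s t) x)
    (hf' : ∀ x ∈ Set.Icc s t, HasDerivWithinAt f' (f'' x) (Set.Icc s t) x)
    (hK : ∀ x ∈ Set.Icc s t, ‖f'' x‖ ≤ K) :
    ‖f t - f s - (t - s) • f' s‖ ≤ K * (t - s) ^ 2 := by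
  have hs : s ∈ Set.Icc s t := Set.left_mem_Icc.2 hst
  have ht : t ∈ Set.Icc s t := Set.right_mem_Icc.2 hst
  have hK0 : 0 ≤ K := (norm_nonneg _).trans (hK s hs)
  have hderiv : ∀ x ∈ Set.Icc s t, ‖f' x - f' s‖ ≤ K * (t - s) := by
    intro x hx
    refine ((convex_Icc s t).norm_image_sub_le_of_norm_hasDerivWithin_le hf' hK hs hx).trans ?_
    rw [Real.norm_of_nonneg (sub_nonneg.2 hx.1)]
    have := hx.2
    gcongr
  have hg : ∀ x ∈ Set.Icc s t,
      HasDerivWithinAt (fun y => f y - (y - s) • f' s) (f' x - f' s) (Set.Icc s t) x := by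
    intro x hx
    simpa using (hf x hx).fun_sub (((hasDerivWithinAt_id x _).sub_const s).smul_const (f' s))
  have h := (convex_Icc s t).norm_image_sub_le_of_norm_hasDerivWithin_le hg hderiv hs ht
  rw [Real.norm_of_nonneg (sub_nonneg.2 hst)] at h
  calc ‖f t - f s - (t - s) • f' s‖
      = ‖f t - (t - s) • f' s - (f s - (s - s) • f' s)‖ := by
        rw [sub_self, zero_smul, sub_zero, sub_right_comm]
    _ ≤ K * (t - s) * (t - s) := h
    _ = K * (t - s) ^ 2 := by ring

/-- A curve with speed at least `1 / K` and second derivative at most `K` moves by at least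
`h / (2 K)` over a parameter interval of length `h ≤ 1 / (2 K ^ 2)`. -/
lemma sub_le_mul_norm_image_sub {E : Type*} [NormedAddCommGroup E] [NormedSpace ℝ E]
    {f f' f'' : ℝ → E} {K s t : ℝ} (hK : 0 < K) (hst : s ≤ t)
    (hsmall : t - s ≤ 1 / (2 * K ^ 2))
    (hf : ∀ x ∈ Set.Icc s t, HasDerivWithinAt f (f' x) (Set.Icc s t) x)
    (hf' : ∀ x ∈ Set.Icc s t, HasDerivWithinAt f' (f'' x) (Set.Icc s t) x)
    (hspeed : 1 / K ≤ ‖f' s‖) (hK' : ∀ x ∈ Set.Icc s t, ‖f'' x‖ ≤ K) :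
    t - s ≤ 2 * K * ‖f t - f s‖ := by
  have h0 : 0 ≤ t - s := sub_nonneg.2 hst
  have htaylor := norm_sub_sub_smul_deriv_le hst hf hf' hK'
  have htri : ‖(t - s) • f' s‖ ≤ ‖f t - f s‖ + ‖f t - f s - (t - s) • f' s‖ :=
    norm_le_norm_add_norm_sub _ _
  rw [norm_smul, Real.norm_of_nonneg h0] at htri
  have hlow : (t - s) * (1 / K) ≤ (t - s) * ‖f' s‖ := by gcongr
  have hmul : K * ((t - s) * (1 / K)) ≤ K * (‖f t - f s‖ + K * (t - s) ^ 2) := by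
    gcongr
    linarith
  have hcancel : K * ((t - s) * (1 / K)) = t - s := by field_simp
  have hquad : K ^ 2 * (t - s) ≤ 1 / 2 := by
    rw [le_div_iff₀ (by positivity)] at hsmall
    linarith
  nlinarith [mul_le_mul_of_nonneg_left hquad h0]

/-- for a `C²` curve `γ : [0,1] → ℂ` with `1/C₀ ≤ |γ'| ≤ C₀` and `|γ''| ≤ C₀`,
there is `C > 0` depending only on `C₀` such that for every `z ∈ ℂ` and `0 < r ≤ 1/(2C₀³)`,
each connected component of `{t ∈ [0,1] : |γ(t) − z| ≤ r}` is contained in an interval of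
length `≤ C·r` (i.e. has diameter `≤ C·r`); in particular the arc of `γ` over each such
component has length `≤ C₀·C·r`. -/
theorem component_near_point_small
    (C₀ : ℝ) (hC₀ : 1 ≤ C₀) :
    ∃ C : ℝ, 0 < C ∧
      ∀ (γ γ' γ'' : ℝ → ℂ),
        (∀ t ∈ Set.Icc (0 : ℝ) 1, HasDerivWithinAt γ (γ' t) (Set.Icc 0 1) t) →
        (∀ t ∈ Set.Icc (0 : ℝ) 1, HasDerivWithinAt γ' (γ'' t) (Set.Icc 0 1) t) →
        ContinuousOn γ'' (Set.Icc 0 1) →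
        (∀ t ∈ Set.Icc (0 : ℝ) 1, 1 / C₀ ≤ ‖γ' t‖ ∧ ‖γ' t‖ ≤ C₀ ∧ ‖γ'' t‖ ≤ C₀) →
        ∀ (z : ℂ) (r : ℝ), 0 < r → r ≤ 1 / (2 * C₀ ^ 3) →
          ∀ t₀ ∈ {t ∈ Set.Icc (0 : ℝ) 1 | ‖γ t - z‖ ≤ r},
            (∀ s ∈ connectedComponentIn {t ∈ Set.Icc (0 : ℝ) 1 | ‖γ t - z‖ ≤ r} t₀,
             ∀ t ∈ connectedComponentIn {t ∈ Set.Icc (0 : ℝ) 1 | ‖γ t - z‖ ≤ r} t₀,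
               |s - t| ≤ C * r) ∧
            (∫ t in connectedComponentIn {t ∈ Set.Icc (0 : ℝ) 1 | ‖γ t - z‖ ≤ r} t₀, ‖γ' t‖) ≤
              C₀ * C * r := by
  have hC₀pos : 0 < C₀ := by linarith
  refine ⟨8 * C₀ ^ 3, by positivity, ?_⟩
  intro γ γ' γ'' hγ hγ' _ hbd z r hr _ t₀ _
  set A : Set ℝ := {t ∈ Set.Icc (0 : ℝ) 1 | ‖γ t - z‖ ≤ r}
  set S := connectedComponentIn A t₀
  have hSA : S ⊆ A := connectedComponentIn_subset _ _
  have hord : S.OrdConnected := isPreconnected_connectedComponentIn.ordConnected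
  have hshort : ∀ s ∈ S, ∀ t ∈ S, s ≤ t → t - s ≤ 1 / (2 * C₀ ^ 2) → t - s ≤ 4 * C₀ * r := by
    intro s hs t ht hst hsmall
    have hsub : Set.Icc s t ⊆ Set.Icc 0 1 :=
      Set.Icc_subset_Icc (hSA hs).1.1 (hSA ht).1.2
    have hmove := sub_le_mul_norm_image_sub hC₀pos hst hsmall
      (fun x hx => (hγ x (hsub hx)).mono hsub) (fun x hx => (hγ' x (hsub hx)).mono hsub)
      (hbd s (hSA hs).1).1 (fun x hx => (hbd x (hsub hx)).2.2)
    have hdist : ‖γ t - γ s‖ ≤ r + r := by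
      have := norm_sub_le (γ t - z) (γ s - z)
      rw [sub_sub_sub_cancel_right] at this
      exact this.trans (add_le_add (hSA ht).2 (hSA hs).2)
    calc t - s ≤ 2 * C₀ * ‖γ t - γ s‖ := hmove
      _ ≤ 2 * C₀ * (r + r) := by gcongr
      _ = 4 * C₀ * r := by ring
  have hlen : ∀ s ∈ S, ∀ t ∈ S, s ≤ t → t - s ≤ 8 * C₀ ^ 3 * r := by
    intro s hs t ht hst
    rcases le_total (t - s) (1 / (2 * C₀ ^ 2)) with h | h
    · have hpow : C₀ ≤ C₀ ^ 3 := le_self_pow₀ hC₀ (by norm_num)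
      calc t - s ≤ 4 * C₀ * r := hshort s hs t ht hst h
        _ ≤ 8 * C₀ ^ 3 * r := by gcongr; norm_num
    · have hpos : 0 < 1 / (2 * C₀ ^ 2) := by positivity
      have hu : s + 1 / (2 * C₀ ^ 2) ∈ S := hord.out hs ht ⟨by linarith, by linarith⟩
      have hle := hshort s hs _ hu (by linarith) (by linarith)
      rw [add_sub_cancel_left, div_le_iff₀ (by positivity)] at hle
      have h1 : t - s ≤ 1 := by linarith [(hSA hs).1.1, (hSA ht).1.2]
      linarith
  have hdiam : ∀ s ∈ S, ∀ t ∈ S, |s - t| ≤ 8 * C₀ ^ 3 * r := by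
    intro s hs t ht
    rcases le_total s t with h | h
    · rw [abs_sub_comm, abs_of_nonneg (sub_nonneg.2 h)]
      exact hlen s hs t ht h
    · rw [abs_of_nonneg (sub_nonneg.2 h)]
      exact hlen t ht s hs h
  refine ⟨hdiam, ?_⟩
  have hvol : volume S ≤ ENNReal.ofReal (8 * C₀ ^ 3 * r) := by
    refine (Real.volume_le_diam S).trans (Metric.ediam_le fun s hs t ht => ?_)
    rw [edist_dist, Real.dist_eq]
    exact ENNReal.ofReal_le_ofReal (hdiam s hs t ht)
  have hint : ‖∫ t in S, ‖γ' t‖‖ ≤ C₀ * volume.real S :=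
    norm_setIntegral_le_of_norm_le_const (hvol.trans_lt ENNReal.ofReal_lt_top) fun t ht => by
      rw [norm_norm]
      exact (hbd t (hSA ht).1).2.1
  calc ∫ t in S, ‖γ' t‖ ≤ C₀ * volume.real S := (Real.le_norm_self _).trans hint
    _ ≤ C₀ * (8 * C₀ ^ 3 * r) := by
      gcongr
      exact ENNReal.toReal_le_of_le_ofReal (by positivity) hvol
    _ = C₀ * (8 * C₀ ^ 3) * r := by ring
end
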